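/- For the Gaussian window, i.e. ĥ(ξ) = exp(−2π²ξ²), the following closed forms hold for every s ∈ ℝ: γ₀(s) = ν₀(s) = (2√π)⁻¹ · exp(−π²s²); γ₁(s) = ν₁(s) = (s/2) · (2√π)⁻¹ · exp(−π²s²); and γ₂(s) = ν₂(s) = (2√π)⁻¹ · (1/(8π²) + s²/4) · exp(−π²s²). (These Gaussian moment–convolution identities are the computational content of the paper's supplementary Lemma on the cross-frequency covariance and pseudocovariance of the STFT of white noise, with the Gaussian exponent computed correctly as π²s².) -/

import Mathlib

open MeasureTheory Real

noncomputable section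

/-- The Fourier transform of the Gaussian window: `ĥ(ξ) = exp(−2π²ξ²)`. -/
def hhat (ξ : ℝ) : ℝ := Real.exp (-2 * Real.pi ^ 2 * ξ ^ 2)

/-- `γ_k(s) = ∫ ξ^k · ĥ(ξ − s) · ĥ(ξ) dξ` for the Gaussian window. -/
def gammaK (k : ℕ) (s : ℝ) : ℝ := ∫ ξ : ℝ, ξ ^ k * hhat (ξ - s) * hhat ξ

/-- `ν_k(s) = ∫ ξ^k · ĥ(ξ) · ĥ(s − ξ) dξ` for the Gaussian window. -/
def nuK (k : ℕ) (s : ℝ) : ℝ := ∫ ξ : ℝ, ξ ^ k * hhat ξ * hhat (s - ξ)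

theorem integrable_sq_mul_exp_neg_mul_sq {b : ℝ} (hb : 0 < b) :
    Integrable fun x : ℝ => x ^ 2 * Real.exp (-b * x ^ 2) := by
  simpa using integrable_rpow_mul_exp_neg_mul_sq hb (s := 2) (by norm_num)

theorem integral_mul_exp_neg_mul_sq {b : ℝ} (hb : 0 < b) :
    ∫ x : ℝ, x * Real.exp (-b * x ^ 2) = 0 := by
  have hderiv (x : ℝ) : HasDerivAt (fun x : ℝ => Real.exp (-b * x ^ 2))
      (-(2 * b) * (x * Real.exp (-b * x ^ 2))) x := by
    convert! (((hasDerivAt_id x).pow 2).const_mul (-b)).exp using 1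
    simp
    ring
  have h := integral_eq_zero_of_hasDerivAt_of_integrable hderiv
    ((integrable_mul_exp_neg_mul_sq hb).const_mul _) (integrable_exp_neg_mul_sq hb)
  rw [integral_const_mul] at h
  exact (mul_eq_zero.mp h).resolve_left (by linarith)

theorem integral_sq_mul_exp_neg_mul_sq {b : ℝ} (hb : 0 < b) :
    ∫ x : ℝ, x ^ 2 * Real.exp (-b * x ^ 2) = 1 / (2 * b) * √(π / b) := by
  have hderiv (x : ℝ) : HasDerivAt (fun x : ℝ => x * Real.exp (-b * x ^ 2))
      (Real.exp (-b * x ^ 2) - 2 * b * (x ^ 2 * Real.exp (-b * x ^ 2))) x := by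
    convert! (hasDerivAt_id x).mul
      (((hasDerivAt_id x).pow 2).const_mul (-b)).exp using 1
    simp
    ring
  have hint := (integrable_sq_mul_exp_neg_mul_sq hb).const_mul (2 * b)
  have h := integral_eq_zero_of_hasDerivAt_of_integrable hderiv
    ((integrable_exp_neg_mul_sq hb).sub hint) (integrable_mul_exp_neg_mul_sq hb)
  rw [integral_sub (integrable_exp_neg_mul_sq hb) hint, integral_const_mul,
    integral_gaussian] at h
  rw [one_div, ← div_eq_inv_mul, eq_div_iff (by positivity)]
  linarith

theorem hhat_neg (ξ : ℝ) : hhat (-ξ) = hhat ξ := by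
  simp [hhat]

theorem nuK_eq_gammaK (k : ℕ) (s : ℝ) : nuK k s = gammaK k s := by
  unfold nuK gammaK
  congr 1 with ξ
  rw [← neg_sub ξ s, hhat_neg]
  ring

/-- Completing the square and recentring at the midpoint `s / 2`. -/
theorem gammaK_eq_integral_recentred (k : ℕ) (s : ℝ) :
    gammaK k s = (∫ u : ℝ, (u + s / 2) ^ k * Real.exp (-(4 * π ^ 2) * u ^ 2)) *
      Real.exp (-π ^ 2 * s ^ 2) := by
  rw [gammaK, ← integral_add_right_eq_self _ (s / 2), ← integral_mul_const]
  congr 1 with u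
  rw [hhat, hhat, mul_assoc, mul_assoc (_ ^ k) (Real.exp _), ← Real.exp_add, ← Real.exp_add]
  ring_nf

theorem sqrt_pi_div_four_mul_pi_sq : √(π / (4 * π ^ 2)) = (2 * √π)⁻¹ := by
  have h : π / (4 * π ^ 2) = ((2 * √π)⁻¹) ^ 2 := by
    rw [inv_pow, mul_pow, Real.sq_sqrt pi_pos.le]
    field_simp
    norm_num
  rw [h, Real.sqrt_sq (by positivity)]

theorem gammaK_zero (s : ℝ) :
    gammaK 0 s = (2 * √π)⁻¹ * Real.exp (-π ^ 2 * s ^ 2) := by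
  simp only [gammaK_eq_integral_recentred, pow_zero, one_mul]
  rw [integral_gaussian, sqrt_pi_div_four_mul_pi_sq]

theorem gammaK_one (s : ℝ) :
    gammaK 1 s = (s / 2) * ((2 * √π)⁻¹ * Real.exp (-π ^ 2 * s ^ 2)) := by
  have hb : 0 < 4 * π ^ 2 := by positivity
  simp only [gammaK_eq_integral_recentred, pow_one, add_mul]
  rw [integral_add (integrable_mul_exp_neg_mul_sq hb)
    ((integrable_exp_neg_mul_sq hb).const_mul _), integral_const_mul,
    integral_mul_exp_neg_mul_sq hb, integral_gaussian, sqrt_pi_div_four_mul_pi_sq]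
  ring

theorem gammaK_two (s : ℝ) :
    gammaK 2 s = (2 * √π)⁻¹ * (1 / (8 * π ^ 2) + s ^ 2 / 4) * Real.exp (-π ^ 2 * s ^ 2) := by
  have hb : 0 < 4 * π ^ 2 := by positivity
  have h₁ := (integrable_mul_exp_neg_mul_sq hb).const_mul s
  have h₀ := (integrable_exp_neg_mul_sq hb).const_mul (s ^ 2 / 4)
  have h₁₀ : Integrable fun u : ℝ => s * (u * Real.exp (-(4 * π ^ 2) * u ^ 2)) +
      s ^ 2 / 4 * Real.exp (-(4 * π ^ 2) * u ^ 2) := h₁.add h₀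
  have hexpand (u : ℝ) : (u + s / 2) ^ 2 * Real.exp (-(4 * π ^ 2) * u ^ 2) =
      u ^ 2 * Real.exp (-(4 * π ^ 2) * u ^ 2) + (s * (u * Real.exp (-(4 * π ^ 2) * u ^ 2)) +
        s ^ 2 / 4 * Real.exp (-(4 * π ^ 2) * u ^ 2)) := by
    ring
  simp only [gammaK_eq_integral_recentred, hexpand]
  rw [integral_add (integrable_sq_mul_exp_neg_mul_sq hb) h₁₀, integral_add h₁ h₀,
    integral_const_mul, integral_const_mul, integral_sq_mul_exp_neg_mul_sq hb,
    integral_mul_exp_neg_mul_sq hb, integral_gaussian, sqrt_pi_div_four_mul_pi_sq]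
  ring

/-- **Gaussian moment–convolution identities.**  For the Gaussian window and every `s ∈ ℝ`:
`γ₀(s) = ν₀(s) = (2√π)⁻¹·e^{−π²s²}`, `γ₁(s) = ν₁(s) = (s/2)·(2√π)⁻¹·e^{−π²s²}`, and
`γ₂(s) = ν₂(s) = (2√π)⁻¹·(1/(8π²) + s²/4)·e^{−π²s²}`. -/
theorem gaussian_window_moment_identities (s : ℝ) :
    gammaK 0 s = (2 * Real.sqrt Real.pi)⁻¹ * Real.exp (-Real.pi ^ 2 * s ^ 2) ∧
    nuK 0 s = (2 * Real.sqrt Real.pi)⁻¹ * Real.exp (-Real.pi ^ 2 * s ^ 2) ∧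
    gammaK 1 s = (s / 2) * ((2 * Real.sqrt Real.pi)⁻¹ * Real.exp (-Real.pi ^ 2 * s ^ 2)) ∧
    nuK 1 s = (s / 2) * ((2 * Real.sqrt Real.pi)⁻¹ * Real.exp (-Real.pi ^ 2 * s ^ 2)) ∧
    gammaK 2 s = (2 * Real.sqrt Real.pi)⁻¹ * (1 / (8 * Real.pi ^ 2) + s ^ 2 / 4) *
      Real.exp (-Real.pi ^ 2 * s ^ 2) ∧
    nuK 2 s = (2 * Real.sqrt Real.pi)⁻¹ * (1 / (8 * Real.pi ^ 2) + s ^ 2 / 4) *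
      Real.exp (-Real.pi ^ 2 * s ^ 2) := by
  simp only [nuK_eq_gammaK]
  exact ⟨gammaK_zero s, gammaK_zero s, gammaK_one s, gammaK_one s, gammaK_two s, gammaK_two s⟩

end
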